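/- Let G be a simple complex Lie group, P a parabolic subgroup with Δ \ Δ_P = {α_{j₁},…,α_{j_r}}. Then the effective good divisibility satisfies e.d.(G/P) = min{ e.d.(G/P_{j_i}) : 1 ≤ i ≤ r }, where P_{j_i} is the maximal parabolic corresponding to Δ \ {α_{j_i}}. -/

import Mathlib

open CoxeterSystem

variable {B W : Type*} [Group W]

/-- Bruhat order on a Coxeter group: `u ≤ w` iff some reduced word for `w` has a
reduced subword expressing `u`. -/
def BruhatLE {M : CoxeterMatrix B} (cs : CoxeterSystem M W) (u w : W) : Prop :=
  ∃ ω : List B, cs.IsReduced ω ∧ cs.wordProd ω = w ∧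
    ∃ ω' : List B, ω'.Sublist ω ∧ cs.IsReduced ω' ∧ cs.wordProd ω' = u

/-- The standard parabolic subgroup `W_S`. -/
def parabolicSubgroup {M : CoxeterMatrix B} (cs : CoxeterSystem M W) (S : Set B) :
    Subgroup W :=
  Subgroup.closure (cs.simple '' S)

/-- `u ∈ W^S`: `u` is the minimal length representative of its coset `u W_S`. -/
def IsMinRep {M : CoxeterMatrix B} (cs : CoxeterSystem M W) (S : Set B) (u : W) : Prop :=
  ∀ i ∈ S, cs.length u < cs.length (u * cs.simple i)

/-- "`e.d.(G/P) ≥ s`", expressed combinatorially: since effective classes on `G/P` are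
nonnegative combinations of Schubert classes `[X_u]`, `u ∈ W^P`, and by positivity of
Schubert structure constants, `e.d.(G/P) ≥ s` holds iff `[X_u] ∪ [X_v] ≠ 0` whenever
`ℓ(u) + ℓ(v) ≤ s`; and `[X_u] ∪ [X_v] ≠ 0` iff `u ≤ w₀ v w_P` in Bruhat order (here
`Δ_P = S`, `w₀` is the longest element of `W` and `w_P` that of `W_P`). -/
def edGE {M : CoxeterMatrix B} (cs : CoxeterSystem M W) (S : Set B) (w0 wP : W)
    (s : ℕ) : Prop :=
  ∀ u v : W, IsMinRep cs S u → IsMinRep cs S v →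
    cs.length u + cs.length v ≤ s → BruhatLE cs u (w0 * v * wP)

namespace CoxeterSystem

section Geometric

open Polynomial.Chebyshev

/-- The linear form `v ↦ 2⟨e_i, v⟩` of the geometric representation. -/
noncomputable def geomForm (M : CoxeterMatrix B) (i : B) : Module.Dual ℝ (B →₀ ℝ) :=
  Finsupp.linearCombination ℝ fun j ↦ -2 * Real.cos (Real.pi / M i j)

lemma geomForm_single (M : CoxeterMatrix B) (i j : B) :
    geomForm M i (Finsupp.single j 1) = -2 * Real.cos (Real.pi / M i j) := by
  simp [geomForm]

lemma geomForm_single_self (M : CoxeterMatrix B) (i : B) :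
    geomForm M i (Finsupp.single i 1) = 2 := by
  simp [geomForm_single]

/-- The simple reflections of the geometric representation. -/
noncomputable def geomReflection (M : CoxeterMatrix B) (i : B) : (B →₀ ℝ) ≃ₗ[ℝ] (B →₀ ℝ) :=
  Module.reflection (geomForm_single_self M i)

lemma eval_S_two_mul_cos_mul_sin (θ : ℝ) (n : ℤ) :
    (S ℝ n).eval (2 * Real.cos θ) * Real.sin θ = Real.sin ((n + 1) * θ) := by
  have h := congrArg (Polynomial.eval (Real.cos θ)) (S_comp_two_mul_X ℝ n)
  simp only [Polynomial.eval_comp, Polynomial.eval_mul, Polynomial.eval_ofNat,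
    Polynomial.eval_X] at h
  rw [h, U_real_cos]

lemma geomReflection_mul_pow (M : CoxeterMatrix B) (i j : B) (hij : i ≠ j) :
    (geomReflection M i * geomReflection M j) ^ M i j = 1 := by
  have h1 : M i j ≠ 1 := M.off_diagonal i j hij
  rcases Nat.eq_zero_or_pos (M i j) with h0 | hpos
  · rw [h0, pow_zero]
  ext1 z
  rw [geomReflection, geomReflection, Module.reflection_mul_reflection_pow_apply _ _ (M i j) z
    _ rfl, geomForm_single, geomForm_single, M.symmetric j i]
  generalize M i j = m at *
  generalize geomForm M i z = p
  generalize geomForm M j z = q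
  have ht : (-2 * Real.cos (Real.pi / m)) * (-2 * Real.cos (Real.pi / m)) - 2
      = 2 * Real.cos (2 * Real.pi / m) := by
    rw [mul_div_assoc, Real.cos_two_mul]; ring
  rw [ht]
  rcases eq_or_ne m 2 with rfl | h2
  · have e : (2 * Real.pi / (2 : ℕ)) = Real.pi := by push_cast; field_simp
    rw [e]
    norm_num
    module
  have hm3 : 3 ≤ m := by omega
  have hmR : (3 : ℝ) ≤ m := by exact_mod_cast hm3
  have hsin : Real.sin (2 * Real.pi / m) ≠ 0 := by
    apply ne_of_gt
    apply Real.sin_pos_of_pos_of_lt_pi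
    · positivity
    · rw [div_lt_iff₀ (by linarith)]
      nlinarith [Real.pi_pos]
  have key (k : ℤ) := eval_S_two_mul_cos_mul_sin (2 * Real.pi / m) k
  have hmθ : (m : ℝ) * (2 * Real.pi / m) = 2 * Real.pi := by field_simp
  generalize 2 * Real.pi / m = θ at *
  rcases Nat.even_or_odd' m with ⟨k, rfl | rfl⟩
  · have e1 : (((2 * k : ℕ) : ℤ) - 2) / 2 = k - 1 := by omega
    have e2 : (((2 * k : ℕ) : ℤ) - 1) / 2 = k - 1 := by omega
    have hS : (S ℝ ((k : ℤ) - 1)).eval (2 * Real.cos θ) = 0 := by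
      apply (mul_eq_zero_iff_right hsin).1
      rw [key]
      have : (((k : ℤ) - 1 : ℤ) + 1 : ℝ) * θ = Real.pi := by
        push_cast at hmθ ⊢; linarith
      rw [this, Real.sin_pi]
    rw [e1, e2, hS]
    simp
  · have e1 : (((2 * k + 1 : ℕ) : ℤ) - 2) / 2 = k - 1 := by omega
    have e2 : (((2 * k + 1 : ℕ) : ℤ) - 1) / 2 = k := by omega
    have e3 : (((2 * k + 1 : ℕ) : ℤ) - 3) / 2 = k - 1 := by omega
    have e4 : (((2 * k + 1 : ℕ) : ℤ)) / 2 = k := by omega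
    have hS : (S ℝ (k : ℤ)).eval (2 * Real.cos θ) + (S ℝ ((k : ℤ) - 1)).eval (2 * Real.cos θ)
        = 0 := by
      apply (mul_eq_zero_iff_right hsin).1
      rw [add_mul, key, key]
      have : (((k : ℤ) : ℝ) + 1) * θ = 2 * Real.pi - (((k : ℤ) - 1 : ℤ) + 1 : ℝ) * θ := by
        push_cast at hmθ ⊢; linarith
      rw [this, Real.sin_two_pi_sub]
      ring
    rw [e1, e2, e3, e4, hS]
    simp

variable {M : CoxeterMatrix B} (cs : CoxeterSystem M W)

lemma isLiftable_geomReflection : M.IsLiftable (geomReflection M) := by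
  intro i j
  rcases eq_or_ne i j with rfl | hij
  · rw [M.diagonal, pow_one]
    ext1 z
    exact Module.involutive_reflection (geomForm_single_self M i) z
  · exact geomReflection_mul_pow M i j hij

theorem simple_injective : Function.Injective cs.simple := by
  intro i j h
  by_contra hij
  have h' := congrArg (cs.lift ⟨_, isLiftable_geomReflection (M := M)⟩) h
  rw [lift_apply_simple, lift_apply_simple] at h'
  have h2 := congrArg (fun f : (B →₀ ℝ) ≃ₗ[ℝ] (B →₀ ℝ) ↦ f (Finsupp.single i 1) i) h'
  simp only [geomReflection, Module.reflection_apply, geomForm_single_self] at h2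
  have hji : j ≠ i := Ne.symm hij
  simp [hji] at h2

end Geometric

section StrongExchange

variable {M : CoxeterMatrix B} (cs : CoxeterSystem M W)

open Classical in
/-- The action of a simple reflection on `W × {±1}`, where the sign records whether the first
component is that reflection. -/
noncomputable def signedConj (i : B) : Function.End (W × ZMod 2) :=
  fun p ↦ (cs.simple i * p.1 * cs.simple i, p.2 + if p.1 = cs.simple i then 1 else 0)

open Classical in
lemma signedConj_mul_pow_apply (i j : B) (n : ℕ) (t : W) (e : ZMod 2) :
    ((cs.signedConj i * cs.signedConj j) ^ n) (t, e) =
      ((cs.simple i * cs.simple j) ^ n * t * ((cs.simple i * cs.simple j) ^ n)⁻¹,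
        e + ∑ l ∈ Finset.range (2 * n),
          if t = cs.simple j * (cs.simple i * cs.simple j) ^ l then 1 else 0) := by
  set x := cs.simple i * cs.simple j with hx
  have hxinv : x⁻¹ = cs.simple j * cs.simple i := by simp [hx]
  have hj (k : ℕ) : (x ^ k)⁻¹ * cs.simple j = cs.simple j * x ^ k := by
    induction k with
    | zero => simp
    | succ k ih =>
      rw [pow_succ, mul_inv_rev, mul_assoc, ih, hxinv, ← pow_succ, pow_succ', hx]
      simp only [mul_assoc]
  induction n with
  | zero => simp; rfl
  | succ n ih =>
    rw [pow_succ']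
    change (cs.signedConj i) ((cs.signedConj j) (((cs.signedConj i * cs.signedConj j) ^ n) (t, e)))
      = _
    rw [ih]
    have c1 : x ^ n * t * (x ^ n)⁻¹ = cs.simple j ↔ t = cs.simple j * x ^ (2 * n) := by
      rw [mul_inv_eq_iff_eq_mul, ← eq_inv_mul_iff_mul_eq, ← mul_assoc, hj, mul_assoc, ← pow_add,
        two_mul]
    have c2 : cs.simple j * (x ^ n * t * (x ^ n)⁻¹) * cs.simple j = cs.simple i ↔
        t = cs.simple j * x ^ (2 * n + 1) := by
      rw [← cs.inv_simple j, mul_inv_eq_iff_eq_mul, ← eq_inv_mul_iff_mul_eq,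
        mul_inv_eq_iff_eq_mul, ← eq_inv_mul_iff_mul_eq, inv_inv, cs.inv_simple, ← hx,
        mul_assoc, mul_assoc, ← mul_assoc, ← mul_assoc, hj, show 2 * n + 1 = n + (1 + n) by ring,
        pow_add, pow_add, pow_one]
      simp only [hx, mul_assoc]
    simp only [signedConj, c1, c2]
    rw [show 2 * (n + 1) = 2 * n + 1 + 1 by ring, Finset.sum_range_succ, Finset.sum_range_succ]
    refine Prod.ext ?_ ?_
    · simp only [pow_succ', mul_inv_rev, hxinv]
      simp only [hx, mul_assoc]
    · simp only [add_assoc]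

lemma isLiftable_signedConj : M.IsLiftable cs.signedConj := by
  classical
  intro i j
  funext p
  obtain ⟨t, e⟩ := p
  rw [signedConj_mul_pow_apply, simple_mul_simple_pow, two_mul, Finset.sum_range_add]
  simp only [pow_add, simple_mul_simple_pow, one_mul, CharTwo.add_self_eq_zero]
  simp
  rfl

/-- The action of `W` on `W × {±1}` extending `signedConj`. -/
noncomputable def signedAction : W →* Function.End (W × ZMod 2) :=
  cs.lift ⟨_, cs.isLiftable_signedConj⟩

open Classical in
lemma signedAction_wordProd (ω : List B) (t : W) (e : ZMod 2) :
    cs.signedAction (cs.wordProd ω) (t, e) =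
      (cs.wordProd ω * t * (cs.wordProd ω)⁻¹, e + (cs.rightInvSeq ω).count t) := by
  induction ω with
  | nil => simp; rfl
  | cons i ω ih =>
    rw [wordProd_cons, map_mul]
    change cs.signedAction (cs.simple i) (cs.signedAction (cs.wordProd ω) (t, e)) = _
    rw [ih, signedAction, lift_apply_simple]
    have c : cs.wordProd ω * t * (cs.wordProd ω)⁻¹ = cs.simple i ↔
        (cs.wordProd ω)⁻¹ * cs.simple i * cs.wordProd ω = t := by
      rw [mul_inv_eq_iff_eq_mul, ← eq_inv_mul_iff_mul_eq, mul_assoc, eq_comm]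
    simp only [signedConj, c, rightInvSeq, List.count_cons, beq_iff_eq]
    refine Prod.ext ?_ ?_
    · simp [mul_assoc]
    · simp [add_assoc]

lemma signedAction_snd_add (w t : W) (e : ZMod 2) :
    cs.signedAction w (t, e) = (w * t * w⁻¹, (cs.signedAction w (t, 0)).2 + e) := by
  classical
  obtain ⟨ω, rfl⟩ := cs.wordProd_surjective w
  rw [signedAction_wordProd, signedAction_wordProd]
  simp [add_comm]

lemma signedAction_reflection {t : W} (ht : cs.IsReflection t) (e : ZMod 2) :
    cs.signedAction t (t, e) = (t, e + 1) := by
  obtain ⟨v, i, rfl⟩ := ht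
  have hv : cs.signedAction v (cs.signedAction v⁻¹ (v * cs.simple i * v⁻¹, e)) =
      (v * cs.simple i * v⁻¹, e) := by
    change (cs.signedAction v * cs.signedAction v⁻¹) _ = _
    rw [← map_mul, mul_inv_cancel, map_one]; rfl
  rw [map_mul, map_mul]
  change cs.signedAction v (cs.signedAction (cs.simple i)
    (cs.signedAction v⁻¹ (v * cs.simple i * v⁻¹, e))) = _
  rw [signedAction_snd_add cs v⁻¹] at hv ⊢
  have h1 : v⁻¹ * (v * cs.simple i * v⁻¹) * v⁻¹⁻¹ = cs.simple i := by group
  rw [h1] at hv ⊢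
  have h2 (a : ZMod 2) : cs.signedAction (cs.simple i) (cs.simple i, a) =
      (cs.simple i, a + 1) := by
    rw [signedAction, lift_apply_simple]
    simp [signedConj]
  rw [h2, signedAction_snd_add] at *
  simp only [Prod.mk.injEq, true_and] at hv ⊢
  rw [← add_assoc, hv]

lemma mem_rightInvSeq_of_length_lt (ω : List B) {t : W} (ht : cs.IsReflection t)
    (h : cs.length (cs.wordProd ω * t) < cs.length (cs.wordProd ω)) :
    t ∈ cs.rightInvSeq ω := by
  classical
  by_contra hmem
  obtain ⟨η, hη, hw⟩ := cs.exists_isReduced (cs.wordProd ω * t)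
  have h1 : cs.signedAction (cs.wordProd ω * t) (t, 0) =
      (cs.wordProd ω * t * (cs.wordProd ω)⁻¹, 1) := by
    rw [map_mul]
    change cs.signedAction (cs.wordProd ω) (cs.signedAction t (t, 0)) = _
    rw [signedAction_reflection cs ht, signedAction_wordProd, List.count_eq_zero_of_not_mem hmem]
    simp
  rw [hw, signedAction_wordProd] at h1
  have h2 : t ∈ cs.rightInvSeq η := by
    by_contra hn
    rw [List.count_eq_zero_of_not_mem hn] at h1
    simp at h1
  have h3 := (cs.isRightInversion_of_mem_rightInvSeq hη h2).2
  rw [← hw, mul_assoc, ht.mul_self, mul_one] at h3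
  omega

/-- The strong exchange property, for multiplication by a reflection on the right. -/
theorem exists_mul_eq_wordProd_eraseIdx (ω : List B) {t : W} (ht : cs.IsReflection t)
    (h : cs.length (cs.wordProd ω * t) < cs.length (cs.wordProd ω)) :
    ∃ k < ω.length, cs.wordProd ω * t = cs.wordProd (ω.eraseIdx k) := by
  obtain ⟨k, hk, hkt⟩ := List.getElem_of_mem (cs.mem_rightInvSeq_of_length_lt ω ht h)
  refine ⟨k, by simpa using hk, ?_⟩
  rw [← cs.wordProd_mul_getD_rightInvSeq, List.getD_eq_getElem _ _ hk, hkt]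

/-- The strong exchange property, for multiplication by a reflection on the left. -/
theorem exists_reflection_mul_eq_wordProd_eraseIdx (ω : List B) {t : W} (ht : cs.IsReflection t)
    (h : cs.length (t * cs.wordProd ω) < cs.length (cs.wordProd ω)) :
    ∃ k < ω.length, t * cs.wordProd ω = cs.wordProd (ω.eraseIdx k) := by
  have e : t * cs.wordProd ω = cs.wordProd ω * ((cs.wordProd ω)⁻¹ * t * cs.wordProd ω) := by group
  have ht' := ht.conj (cs.wordProd ω)⁻¹
  rw [inv_inv] at ht'
  rw [e] at h ⊢
  exact exists_mul_eq_wordProd_eraseIdx cs ω ht' h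

/-- The deletion property: every word contains a reduced subword with the same product. -/
theorem exists_isReduced_sublist (ω : List B) :
    ∃ ω' : List B, ω'.Sublist ω ∧ cs.IsReduced ω' ∧ cs.wordProd ω' = cs.wordProd ω := by
  induction ω with
  | nil => exact ⟨[], List.Sublist.refl _, by simp [IsReduced], rfl⟩
  | cons i ω ih =>
    obtain ⟨η, hsub, hred, hprod⟩ := ih
    rcases cs.length_simple_mul (cs.wordProd η) i with h | h
    · refine ⟨i :: η, hsub.cons_cons i, ?_, by rw [wordProd_cons, wordProd_cons, hprod]⟩
      rw [IsReduced, wordProd_cons, h, hred.eq, List.length_cons]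
    · obtain ⟨k, hk, he⟩ := cs.exists_reflection_mul_eq_wordProd_eraseIdx η
        (cs.isReflection_simple i) (by omega)
      refine ⟨η.eraseIdx k, ((List.eraseIdx_sublist η k).trans hsub).cons i, ?_, ?_⟩
      · rw [IsReduced, ← he, List.length_eraseIdx_of_lt hk, ← hred.eq]
        omega
      · rw [← he, hprod, wordProd_cons]

end StrongExchange

section Bruhat

variable {M : CoxeterMatrix B} (cs : CoxeterSystem M W)

/-- `u` is obtained from `w` by a length-decreasing left multiplication by a reflection. -/
def ReflectionStep (u w : W) : Prop :=
  cs.length u < cs.length w ∧ ∃ t, cs.IsReflection t ∧ u = t * w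

/-- The Bruhat order, described by chains of reflections. -/
def ReflectionLE : W → W → Prop := Relation.ReflTransGen cs.ReflectionStep

lemma reflectionLE_simple_mul {w : W} {i : B} (h : cs.length w < cs.length (cs.simple i * w)) :
    cs.ReflectionLE w (cs.simple i * w) :=
  .single ⟨h, cs.simple i, cs.isReflection_simple i, by simp⟩

lemma simple_mul_reflectionLE {w : W} {i : B} (h : cs.length (cs.simple i * w) < cs.length w) :
    cs.ReflectionLE (cs.simple i * w) w :=
  .single ⟨h, cs.simple i, cs.isReflection_simple i, rfl⟩

lemma ReflectionStep.simple_mul_le_or {u w : W} (h : cs.ReflectionStep u w) (i : B) :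
    cs.ReflectionLE (cs.simple i * u) w ∨
      cs.ReflectionLE (cs.simple i * u) (cs.simple i * w) := by
  have hstep := h
  obtain ⟨hlt, t, ht, rfl⟩ := h
  by_cases hti : t = cs.simple i
  · left
    rw [hti, simple_mul_simple_cancel_left]
    exact .refl
  rcases lt_or_gt_of_ne (cs.length_simple_mul_ne (t * w) i) with hd | hu
  · exact .inl ((cs.simple_mul_reflectionLE hd).trans (.single hstep))
  right
  have ht' : cs.IsReflection (cs.simple i * t * cs.simple i) := by
    simpa using ht.conj (cs.simple i)
  have e : cs.simple i * (t * w) = cs.simple i * t * cs.simple i * (cs.simple i * w) := by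
    simp [mul_assoc]
  refine .single ⟨?_, _, ht', e⟩
  by_contra hnlt
  have hlt' : cs.length (cs.simple i * w) < cs.length (cs.simple i * (t * w)) := by
    refine lt_of_le_of_ne (not_lt.1 hnlt) ?_
    rw [e]
    exact (ht'.length_mul_right_ne (cs.simple i * w)).symm
  obtain ⟨ω, hω, hw⟩ := cs.exists_isReduced (t * w)
  have e2 : cs.simple i * w = cs.simple i * t * cs.simple i * cs.wordProd (i :: ω) := by
    rw [wordProd_cons, ← hw]
    simp only [mul_assoc, simple_mul_simple_cancel_left]
    rw [← mul_assoc t t, ht.mul_self, one_mul]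
  rw [hw, ← wordProd_cons, e2] at hlt'
  obtain ⟨k, hk, hke⟩ := cs.exists_reflection_mul_eq_wordProd_eraseIdx (i :: ω) ht' hlt'
  rw [← e2] at hke
  rcases k with _ | k
  · simp only [List.eraseIdx_zero, List.tail_cons, ← hw] at hke
    exact hti (mul_right_cancel hke).symm
  · simp only [List.eraseIdx_cons_succ, wordProd_cons, mul_right_inj] at hke
    have := cs.length_wordProd_le (ω.eraseIdx k)
    have h1 := List.length_eraseIdx_le ω k
    have h2 := hω.eq
    rw [← hw] at h2
    rw [← hke] at this
    omega

lemma ReflectionLE.simple_mul_le_or {u w : W} (h : cs.ReflectionLE u w) (i : B) :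
    cs.ReflectionLE (cs.simple i * u) w ∨
      cs.ReflectionLE (cs.simple i * u) (cs.simple i * w) := by
  induction h using Relation.ReflTransGen.head_induction_on with
  | refl => exact .inr .refl
  | head hstep htail ih =>
    rcases ReflectionStep.simple_mul_le_or cs hstep i with h | h
    · exact .inl (h.trans htail)
    · exact ih.imp h.trans h.trans

lemma reflectionLE_of_sublist {ω ω' : List B} (hsub : ω'.Sublist ω) (hω : cs.IsReduced ω) :
    cs.ReflectionLE (cs.wordProd ω') (cs.wordProd ω) := by
  induction hsub with
  | slnil => exact .refl
  | @cons l₁ l₂ i _ ih =>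
    have hl₂ : cs.IsReduced l₂ := by simpa using hω.drop 1
    refine (ih hl₂).trans ?_
    rw [wordProd_cons]
    apply reflectionLE_simple_mul
    rw [← wordProd_cons, hω.eq, hl₂.eq]
    simp
  | @cons_cons l₁ l₂ i _ ih =>
    have hl₂ : cs.IsReduced l₂ := by simpa using hω.drop 1
    rw [wordProd_cons, wordProd_cons]
    rcases ReflectionLE.simple_mul_le_or cs (ih hl₂) i with h | h
    · refine h.trans ?_
      apply reflectionLE_simple_mul
      rw [← wordProd_cons, hω.eq, hl₂.eq]
      simp
    · exact h

lemma ReflectionLE.exists_sublist {u w : W} (h : cs.ReflectionLE u w) {ω : List B}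
    (hw : cs.wordProd ω = w) :
    ∃ ω' : List B, ω'.Sublist ω ∧ cs.IsReduced ω' ∧ cs.wordProd ω' = u := by
  suffices ∃ ω' : List B, ω'.Sublist ω ∧ cs.wordProd ω' = u by
    obtain ⟨ω₁, hsub, rfl⟩ := this
    obtain ⟨ω₂, hsub', hred, he⟩ := cs.exists_isReduced_sublist ω₁
    exact ⟨ω₂, hsub'.trans hsub, hred, he⟩
  induction h using Relation.ReflTransGen.head_induction_on with
  | refl => exact ⟨ω, .refl _, hw⟩
  | head hstep _ ih =>
    obtain ⟨η, hsub, rfl⟩ := ih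
    obtain ⟨hlt, t, ht, rfl⟩ := hstep
    obtain ⟨k, -, hk⟩ := cs.exists_reflection_mul_eq_wordProd_eraseIdx η ht hlt
    exact ⟨_, (List.eraseIdx_sublist η k).trans hsub, hk.symm⟩

theorem bruhatLE_iff_reflectionLE {u w : W} : BruhatLE cs u w ↔ cs.ReflectionLE u w := by
  constructor
  · rintro ⟨ω, hω, rfl, ω', hsub, -, rfl⟩
    exact cs.reflectionLE_of_sublist hsub hω
  · intro h
    obtain ⟨ω, hω, rfl⟩ := cs.exists_isReduced w
    exact ⟨ω, hω, rfl, h.exists_sublist cs rfl⟩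

/-- The subword property: the choice of the reduced word is irrelevant. -/
lemma exists_sublist_of_bruhatLE {u : W} {ω : List B} (h : BruhatLE cs u (cs.wordProd ω)) :
    ∃ ω' : List B, ω'.Sublist ω ∧ cs.IsReduced ω' ∧ cs.wordProd ω' = u :=
  ((bruhatLE_iff_reflectionLE cs).1 h).exists_sublist cs rfl

lemma bruhatLE_trans {u v w : W} (h₁ : BruhatLE cs u v) (h₂ : BruhatLE cs v w) :
    BruhatLE cs u w := by
  rw [bruhatLE_iff_reflectionLE] at *
  exact h₁.trans h₂

lemma bruhatLE_refl (u : W) : BruhatLE cs u u :=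
  (bruhatLE_iff_reflectionLE cs).2 .refl

lemma simple_mul_bruhatLE {w : W} {i : B} (h : cs.IsLeftDescent w i) :
    BruhatLE cs (cs.simple i * w) w :=
  (bruhatLE_iff_reflectionLE cs).2 (cs.simple_mul_reflectionLE h)

lemma eq_one_of_bruhatLE_one {u : W} (h : BruhatLE cs u 1) : u = 1 := by
  rw [← cs.wordProd_nil] at h
  obtain ⟨ω', hsub, -, rfl⟩ := cs.exists_sublist_of_bruhatLE h
  rw [List.sublist_nil.1 hsub, wordProd_nil]

lemma bruhatLE_mul_of_length_eq {u x : W} (h : cs.length (u * x) = cs.length u + cs.length x) :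
    BruhatLE cs u (u * x) := by
  obtain ⟨ω, hω, rfl⟩ := cs.exists_isReduced u
  obtain ⟨η, hη, rfl⟩ := cs.exists_isReduced x
  refine ⟨ω ++ η, ?_, cs.wordProd_append ω η, ω, List.sublist_append_left ω η, hω, rfl⟩
  rw [IsReduced, wordProd_append, h, hω.eq, hη.eq, List.length_append]

lemma IsLeftDescent.exists_isReduced_cons {w : W} {i : B} (h : cs.IsLeftDescent w i) :
    ∃ ω : List B, cs.IsReduced ω ∧ cs.IsReduced (i :: ω) ∧ cs.wordProd (i :: ω) = w ∧
      cs.wordProd ω = cs.simple i * w := by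
  obtain ⟨ω, hω, hw⟩ := cs.exists_isReduced (cs.simple i * w)
  have hprod : cs.wordProd (i :: ω) = w := by
    rw [wordProd_cons, ← hw, simple_mul_simple_cancel_left]
  refine ⟨ω, hω, ?_, hprod, hw.symm⟩
  have h1 := cs.isLeftDescent_iff.1 h
  have h2 := hω.eq
  rw [← hw] at h2
  rw [IsReduced, hprod, List.length_cons]
  omega

/-- Lifting property, when only the larger element has the descent. -/
lemma bruhatLE_simple_mul_of_not_isLeftDescent {u w : W} {i : B} (h : BruhatLE cs u w)
    (hw : cs.IsLeftDescent w i) (hu : ¬ cs.IsLeftDescent u i) :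
    BruhatLE cs u (cs.simple i * w) := by
  obtain ⟨ω, hω, -, rfl, hsw⟩ := IsLeftDescent.exists_isReduced_cons cs hw
  obtain ⟨ω', hsub, hred, rfl⟩ := cs.exists_sublist_of_bruhatLE h
  rw [← hsw]
  rcases List.sublist_cons_iff.1 hsub with hsub | ⟨r, rfl, hsub⟩
  · exact ⟨ω, hω, rfl, ω', hsub, hred, rfl⟩
  · refine absurd ?_ hu
    have h1 := hred.eq
    have h2 := cs.length_wordProd_le r
    rw [List.length_cons] at h1
    rw [IsLeftDescent, h1, wordProd_cons, simple_mul_simple_cancel_left]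
    omega

/-- Lifting property, when both elements have the descent. -/
lemma simple_mul_bruhatLE_simple_mul {u w : W} {i : B} (h : BruhatLE cs u w)
    (hw : cs.IsLeftDescent w i) (hu : cs.IsLeftDescent u i) :
    BruhatLE cs (cs.simple i * u) (cs.simple i * w) := by
  refine cs.bruhatLE_simple_mul_of_not_isLeftDescent
    (cs.bruhatLE_trans (cs.simple_mul_bruhatLE hu) h) hw ?_
  rwa [← cs.isLeftDescent_iff_not_isLeftDescent_mul]

lemma simple_mul_bruhatLE_of_isLeftDescent {u w : W} {i : B} (h : BruhatLE cs u w)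
    (hw : cs.IsLeftDescent w i) : BruhatLE cs (cs.simple i * u) w := by
  have hsw := (bruhatLE_iff_reflectionLE cs).1 (cs.simple_mul_bruhatLE hw)
  rw [bruhatLE_iff_reflectionLE] at *
  rcases h.simple_mul_le_or cs i with h | h
  · exact h
  · exact h.trans hsw

end Bruhat

section Parabolic

variable {M : CoxeterMatrix B} (cs : CoxeterSystem M W)

lemma simple_mem_parabolicSubgroup {S : Set B} {i : B} (hi : i ∈ S) :
    cs.simple i ∈ parabolicSubgroup cs S :=
  Subgroup.subset_closure (Set.mem_image_of_mem _ hi)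

lemma parabolicSubgroup_mono {S T : Set B} (h : S ⊆ T) :
    parabolicSubgroup cs S ≤ parabolicSubgroup cs T :=
  Subgroup.closure_mono (Set.image_mono h)

lemma wordProd_mem_parabolicSubgroup {S : Set B} {ω : List B} (h : ∀ i ∈ ω, i ∈ S) :
    cs.wordProd ω ∈ parabolicSubgroup cs S := by
  induction ω with
  | nil => simp [one_mem]
  | cons i ω ih =>
    rw [wordProd_cons]
    exact mul_mem (cs.simple_mem_parabolicSubgroup (h i (by simp)))
      (ih fun j hj ↦ h j (by simp [hj]))

lemma exists_isReduced_of_mem_parabolicSubgroup {S : Set B} {x : W}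
    (hx : x ∈ parabolicSubgroup cs S) :
    ∃ ω : List B, (∀ i ∈ ω, i ∈ S) ∧ cs.IsReduced ω ∧ cs.wordProd ω = x := by
  suffices ∃ ω : List B, (∀ i ∈ ω, i ∈ S) ∧ cs.wordProd ω = x by
    obtain ⟨ω, hS, rfl⟩ := this
    obtain ⟨ω', hsub, hred, he⟩ := cs.exists_isReduced_sublist ω
    exact ⟨ω', fun i hi ↦ hS i (hsub.subset hi), hred, he⟩
  induction hx using Subgroup.closure_induction with
  | mem x hx =>
    obtain ⟨i, hi, rfl⟩ := hx
    exact ⟨[i], by simpa using hi, by simp⟩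
  | one => exact ⟨[], by simp, by simp⟩
  | mul x y _ _ hx hy =>
    obtain ⟨ω, hω, rfl⟩ := hx
    obtain ⟨η, hη, rfl⟩ := hy
    refine ⟨ω ++ η, fun i hi ↦ ?_, cs.wordProd_append ω η⟩
    exact (List.mem_append.1 hi).elim (hω i) (hη i)
  | inv x _ hx =>
    obtain ⟨ω, hω, rfl⟩ := hx
    exact ⟨ω.reverse, fun i hi ↦ hω i (List.mem_reverse.1 hi), cs.wordProd_reverse ω⟩

lemma length_wordProd_mul_simple_lt {ω : List B} {i : B} (h : cs.IsReduced (ω ++ [i])) :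
    cs.length (cs.wordProd (ω ++ [i]) * cs.simple i) < cs.length (cs.wordProd (ω ++ [i])) := by
  rw [h.eq, wordProd_append, wordProd_singleton, simple_mul_simple_cancel_right]
  have := cs.length_wordProd_le ω
  simp
  omega

lemma length_mul_of_minimal {S : Set B} {u : W}
    (hu : ∀ x ∈ parabolicSubgroup cs S, cs.length u ≤ cs.length (u * x))
    {x : W} (hx : x ∈ parabolicSubgroup cs S) :
    cs.length (u * x) = cs.length u + cs.length x := by
  obtain ⟨ω, hωS, hω, rfl⟩ := cs.exists_isReduced_of_mem_parabolicSubgroup hx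
  clear hx
  induction ω using List.reverseRecOn with
  | nil => simp
  | append_singleton ω i ih =>
    have hω' : cs.IsReduced ω := by simpa using hω.take ω.length
    have hωS' : ∀ j ∈ ω, j ∈ S := fun j hj ↦ hωS j (by simp [hj])
    have ih := ih hωS' hω'
    have e : u * cs.wordProd (ω ++ [i]) = u * cs.wordProd ω * cs.simple i := by
      simp [wordProd_append, mul_assoc]
    rw [hω.eq, e]
    rw [hω'.eq] at ih
    rcases cs.length_mul_simple (u * cs.wordProd ω) i with h | h
    · rw [h, ih, List.length_append, List.length_singleton, add_assoc]
    exfalso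
    obtain ⟨η, hη, rfl⟩ := cs.exists_isReduced u
    obtain ⟨k, hk, hke⟩ := cs.exists_mul_eq_wordProd_eraseIdx (η ++ ω) (cs.isReflection_simple i)
      (by rw [wordProd_append]; omega)
    rw [wordProd_append] at hke
    rcases lt_or_ge k η.length with hkη | hkη
    · rw [List.eraseIdx_append_of_lt_length hkη, wordProd_append] at hke
      have hy : cs.wordProd ω * cs.simple i * (cs.wordProd ω)⁻¹ ∈ parabolicSubgroup cs S :=
        mul_mem (mul_mem (cs.wordProd_mem_parabolicSubgroup hωS')
          (cs.simple_mem_parabolicSubgroup (hωS i (by simp))))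
          (inv_mem (cs.wordProd_mem_parabolicSubgroup hωS'))
      have h1 := hu _ hy
      have h2 : cs.wordProd η * (cs.wordProd ω * cs.simple i * (cs.wordProd ω)⁻¹) =
          cs.wordProd (η.eraseIdx k) := by
        rw [← mul_assoc, ← mul_assoc, hke, mul_inv_cancel_right]
      have h3 := cs.length_wordProd_le (η.eraseIdx k)
      rw [List.length_eraseIdx_of_lt hkη, ← h2] at h3
      have h4 := hη.eq
      omega
    · rw [List.eraseIdx_append_of_length_le hkη, wordProd_append, mul_assoc, mul_right_inj] at hke
      have h1 := hω.eq
      rw [wordProd_append, wordProd_singleton, hke] at h1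
      have h3 := cs.length_wordProd_le (ω.eraseIdx (k - η.length))
      have h4 := List.length_eraseIdx_le ω (k - η.length)
      simp at h1
      omega

lemma isMinRep_of_minimal {S : Set B} {u : W}
    (hu : ∀ x ∈ parabolicSubgroup cs S, cs.length u ≤ cs.length (u * x)) : IsMinRep cs S u :=
  fun i hi ↦ by
    rw [cs.length_mul_of_minimal hu (cs.simple_mem_parabolicSubgroup hi), length_simple]
    omega

lemma exists_minimal (S : Set B) (w : W) : ∃ u, u⁻¹ * w ∈ parabolicSubgroup cs S ∧
    ∀ x ∈ parabolicSubgroup cs S, cs.length u ≤ cs.length (u * x) := by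
  obtain ⟨u, hu, hmin⟩ := WellFounded.has_min (measure cs.length).wf
    {u | u⁻¹ * w ∈ parabolicSubgroup cs S} ⟨w, by simp [one_mem]⟩
  refine ⟨u, hu, fun x hx ↦ not_lt.1 (hmin (u * x) ?_)⟩
  simp only [Set.mem_ofPred_eq, mul_inv_rev, mul_assoc]
  exact mul_mem (inv_mem hx) hu

theorem length_mul_of_isMinRep {S : Set B} {u x : W} (hu : IsMinRep cs S u)
    (hx : x ∈ parabolicSubgroup cs S) : cs.length (u * x) = cs.length u + cs.length x := by
  refine cs.length_mul_of_minimal (fun y hy ↦ ?_) hx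
  obtain ⟨v, hv, hmin⟩ := cs.exists_minimal S u
  obtain ⟨ω, hωS, hω, he⟩ := cs.exists_isReduced_of_mem_parabolicSubgroup hv
  have hu' : u = v * cs.wordProd ω := by rw [he, mul_inv_cancel_left]
  rcases List.eq_nil_or_concat' ω with rfl | ⟨η, i, rfl⟩
  · rw [wordProd_nil, mul_one] at hu'
    exact hu' ▸ hmin y hy
  · have hi := hωS i (by simp)
    have h1 := hu i hi
    have hmem := cs.wordProd_mem_parabolicSubgroup hωS
    rw [hu', mul_assoc, cs.length_mul_of_minimal hmin hmem,
      cs.length_mul_of_minimal hmin (mul_mem hmem (cs.simple_mem_parabolicSubgroup hi))] at h1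
    have h2 := cs.length_wordProd_mul_simple_lt hω
    omega

lemma isMinRep_one (S : Set B) : IsMinRep cs S (1 : W) := fun i _ ↦ by simp

/-- `u` is the minimal representative of the coset `w W_S`. -/
def IsProj (S : Set B) (w u : W) : Prop :=
  IsMinRep cs S u ∧ u⁻¹ * w ∈ parabolicSubgroup cs S

lemma exists_isProj (S : Set B) (w : W) : ∃ u, cs.IsProj S w u := by
  obtain ⟨u, hu, hmin⟩ := cs.exists_minimal S w
  exact ⟨u, cs.isMinRep_of_minimal hmin, hu⟩

variable {cs}

lemma IsProj.length_eq {S : Set B} {w u : W} (h : cs.IsProj S w u) :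
    cs.length w = cs.length u + cs.length (u⁻¹ * w) := by
  rw [← length_mul_of_isMinRep cs h.1 h.2, mul_inv_cancel_left]

lemma IsProj.bruhatLE {S : Set B} {w u : W} (h : cs.IsProj S w u) : BruhatLE cs u w := by
  have := cs.bruhatLE_mul_of_length_eq (u := u) (x := u⁻¹ * w) (by
    rw [mul_inv_cancel_left, h.length_eq])
  rwa [mul_inv_cancel_left] at this

lemma IsProj.of_coset {S : Set B} {w w' u : W} (h : cs.IsProj S w u)
    (hw : w⁻¹ * w' ∈ parabolicSubgroup cs S) : cs.IsProj S w' u := by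
  refine ⟨h.1, ?_⟩
  have := mul_mem h.2 hw
  rwa [mul_assoc, mul_inv_cancel_left] at this

lemma IsProj.unique {S : Set B} {w u v : W} (hu : cs.IsProj S w u) (hv : cs.IsProj S w v) :
    u = v := by
  have hmem : v⁻¹ * u ∈ parabolicSubgroup cs S := by
    have := mul_mem hv.2 (inv_mem hu.2)
    simpa [mul_assoc] using this
  have h1 := length_mul_of_isMinRep cs hv.1 hmem
  have h2 := length_mul_of_isMinRep cs hu.1 (inv_mem hmem)
  rw [mul_inv_cancel_left] at h1
  rw [length_inv, mul_inv_rev, inv_inv, mul_inv_cancel_left] at h2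
  have h3 : cs.length (v⁻¹ * u) = 0 := by omega
  rw [length_eq_zero_iff, inv_mul_eq_one] at h3
  exact h3.symm

/-- If `u` is a minimal representative below `w`, it is below the projection of `w`. -/
lemma IsProj.bruhatLE_of_isMinRep {S : Set B} {w u v : W} (hv : cs.IsProj S w v)
    (hu : IsMinRep cs S u) (h : BruhatLE cs u w) : BruhatLE cs u v := by
  obtain ⟨ω, hω, rfl⟩ := cs.exists_isReduced v
  obtain ⟨η, hηS, -, hη⟩ := cs.exists_isReduced_of_mem_parabolicSubgroup hv.2
  have hw : cs.wordProd (ω ++ η) = w := by rw [wordProd_append, hη, mul_inv_cancel_left]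
  rw [← hw] at h
  obtain ⟨ρ, hsub, hρ, rfl⟩ := cs.exists_sublist_of_bruhatLE h
  obtain ⟨α, β, rfl, hα, hβ⟩ := List.sublist_append_iff.1 hsub
  rcases List.eq_nil_or_concat' β with rfl | ⟨γ, i, rfl⟩
  · rw [List.append_nil] at hρ ⊢
    exact ⟨ω, hω, rfl, α, hα, hρ, rfl⟩
  · rw [← List.append_assoc] at hρ hu
    have h1 := hu i (hηS i (hβ.subset (by simp)))
    have h2 := cs.length_wordProd_mul_simple_lt hρ
    omega

lemma isMinRep_simple_mul_of_isLeftDescent {S : Set B} {u : W} {i : B} (hu : IsMinRep cs S u)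
    (hi : cs.IsLeftDescent u i) : IsMinRep cs S (cs.simple i * u) := by
  intro j hj
  have h1 := hu j hj
  have h2 := cs.isLeftDescent_iff.1 hi
  have h3 := cs.length_simple_mul (u * cs.simple j) i
  have h4 := cs.length_mul_simple_ne (cs.simple i * u) j
  rw [mul_assoc] at h4 ⊢
  omega

lemma exists_simple_mul_eq_mul_simple {S : Set B} {u : W} {i : B} (hu : IsMinRep cs S u)
    (h : ¬ IsMinRep cs S (cs.simple i * u)) :
    ∃ j ∈ S, cs.simple i * u = u * cs.simple j := by
  have hi : ¬ cs.IsLeftDescent u i := fun hi ↦ h (isMinRep_simple_mul_of_isLeftDescent hu hi)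
  simp only [IsMinRep, not_forall, not_lt] at h
  obtain ⟨j, hj, hle⟩ := h
  refine ⟨j, hj, ?_⟩
  have h1 := hu j hj
  have h2 := cs.not_isLeftDescent_iff.1 hi
  obtain ⟨ω, hω, rfl⟩ := cs.exists_isReduced u
  have hlt := lt_of_le_of_ne hle (cs.length_mul_simple_ne _ _)
  rw [← wordProd_cons] at hlt
  obtain ⟨k, hk, hke⟩ := cs.exists_mul_eq_wordProd_eraseIdx _ (cs.isReflection_simple j) hlt
  rcases k with _ | k
  · rw [List.eraseIdx_zero, List.tail_cons, wordProd_cons] at hke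
    nth_rewrite 2 [← hke]
    simp
  · rw [List.eraseIdx_cons_succ, wordProd_cons, wordProd_cons, mul_assoc, mul_right_inj] at hke
    have h3 := cs.length_wordProd_le (ω.eraseIdx k)
    have h4 := List.length_eraseIdx_le ω k
    have h5 := hω.eq
    rw [← hke] at h3
    omega

lemma IsProj.simple_mul {S : Set B} {w u : W} {i : B} (h : cs.IsProj S w u)
    (hi : cs.IsLeftDescent w i) :
    (cs.IsLeftDescent u i ∧ cs.IsProj S (cs.simple i * w) (cs.simple i * u)) ∨
      (¬ cs.IsLeftDescent u i ∧ cs.IsProj S (cs.simple i * w) u) := by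
  have hmem : (cs.simple i * u)⁻¹ * (cs.simple i * w) ∈ parabolicSubgroup cs S := by
    simpa [mul_assoc] using h.2
  by_cases hui : cs.IsLeftDescent u i
  · exact .inl ⟨hui, isMinRep_simple_mul_of_isLeftDescent h.1 hui, hmem⟩
  refine .inr ⟨hui, h.1, ?_⟩
  have hn : ¬ IsMinRep cs S (cs.simple i * u) := by
    intro hmin
    have h1 := (IsProj.length_eq (cs := cs) ⟨hmin, hmem⟩)
    have h2 := h.length_eq
    have h3 := cs.not_isLeftDescent_iff.1 hui
    have h4 := cs.isLeftDescent_iff.1 hi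
    have e : (cs.simple i * u)⁻¹ * (cs.simple i * w) = u⁻¹ * w := by simp [mul_assoc]
    rw [e] at h1
    omega
  obtain ⟨j, hj, he⟩ := exists_simple_mul_eq_mul_simple h.1 hn
  have e : u⁻¹ * (cs.simple i * w) = cs.simple j * (u⁻¹ * w) := by
    rw [eq_comm, ← mul_assoc, ← mul_assoc, mul_left_inj, eq_inv_mul_iff_mul_eq, ← mul_assoc, ← he,
      mul_inv_cancel_right]
  rw [e]
  exact mul_mem (cs.simple_mem_parabolicSubgroup hj) h.2

lemma IsProj.not_isLeftDescent {S : Set B} {w u : W} {i : B} (h : cs.IsProj S w u)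
    (hi : ¬ cs.IsLeftDescent w i) : ¬ cs.IsLeftDescent u i := by
  intro hui
  apply hi
  rw [IsLeftDescent] at *
  have h1 := h.length_eq
  have h2 := cs.length_mul_le (cs.simple i * u) (u⁻¹ * w)
  rw [mul_assoc, mul_inv_cancel_left] at h2
  omega

lemma not_isRightDescent_of_mem_parabolicSubgroup {S : Set B} {x : W} {i : B}
    (hx : x ∈ parabolicSubgroup cs S) (hi : i ∉ S) : ¬ cs.IsRightDescent x i := by
  intro hd
  obtain ⟨ω, hωS, -, rfl⟩ := cs.exists_isReduced_of_mem_parabolicSubgroup hx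
  obtain ⟨k, -, hk⟩ := cs.exists_mul_eq_wordProd_eraseIdx ω (cs.isReflection_simple i) hd
  have hmem : cs.simple i ∈ parabolicSubgroup cs S := by
    rw [← inv_mul_eq_iff_eq_mul.2 hk.symm]
    exact mul_mem (inv_mem hx) (cs.wordProd_mem_parabolicSubgroup fun j hj ↦
      hωS j ((List.eraseIdx_sublist ω k).subset hj))
  obtain ⟨η, hηS, hη, he⟩ := cs.exists_isReduced_of_mem_parabolicSubgroup hmem
  have hlen := hη.eq
  rw [he, length_simple, eq_comm, List.length_eq_one_iff] at hlen
  obtain ⟨j, rfl⟩ := hlen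
  rw [wordProd_singleton] at he
  exact hi (cs.simple_injective he ▸ hηS j (by simp))

/-- The criterion of Deodhar: a minimal representative is below `y` as soon as this holds after
projecting to every maximal parabolic quotient. -/
theorem bruhatLE_of_forall_isProj {S : Set B} {x y : W} (hx : IsMinRep cs S x)
    (h : ∀ i ∉ S, ∀ a b, cs.IsProj {i}ᶜ x a → cs.IsProj {i}ᶜ y b → BruhatLE cs a b) :
    BruhatLE cs x y := by
  induction hn : cs.length y generalizing x y with
  | zero =>
    rw [length_eq_zero_iff] at hn
    subst hn
    suffices x = 1 by rw [this]; exact cs.bruhatLE_refl 1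
    by_contra hx1
    obtain ⟨r, hr⟩ := cs.exists_rightDescent_of_ne_one hx1
    by_cases hrS : r ∈ S
    · exact lt_asymm hr (hx r hrS)
    obtain ⟨a, ha⟩ := cs.exists_isProj {r}ᶜ x
    have ha1 := cs.eq_one_of_bruhatLE_one (h r hrS a 1 ha ⟨cs.isMinRep_one _, by simp [one_mem]⟩)
    have hmem := ha.2
    rw [ha1, inv_one, one_mul] at hmem
    exact not_isRightDescent_of_mem_parabolicSubgroup hmem (by simp) hr
  | succ n ih =>
    have hy1 : y ≠ 1 := by
      rintro rfl
      simp at hn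
    obtain ⟨s, hs⟩ := cs.exists_leftDescent_of_ne_one hy1
    have hn' : cs.length (cs.simple s * y) = n := by
      have := cs.isLeftDescent_iff.1 hs
      omega
    by_cases hxs : cs.IsLeftDescent x s
    · have key : BruhatLE cs (cs.simple s * x) (cs.simple s * y) := by
        refine ih (isMinRep_simple_mul_of_isLeftDescent hx hxs) ?_ hn'
        intro i hi a' b' ha' hb'
        obtain ⟨a, ha⟩ := cs.exists_isProj {i}ᶜ x
        obtain ⟨b, hb⟩ := cs.exists_isProj {i}ᶜ y
        have hab := h i hi a b ha hb
        rcases ha.simple_mul hxs with ⟨has, ha2⟩ | ⟨has, ha2⟩ <;>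
        rcases hb.simple_mul hs with ⟨hbs, hb2⟩ | ⟨hbs, hb2⟩ <;>
        rw [ha'.unique ha2, hb'.unique hb2]
        · exact cs.simple_mul_bruhatLE_simple_mul hab hbs has
        · exact cs.bruhatLE_trans (cs.simple_mul_bruhatLE has) hab
        · exact cs.bruhatLE_simple_mul_of_not_isLeftDescent hab hbs has
        · exact hab
      have := cs.simple_mul_bruhatLE_of_isLeftDescent
        (cs.bruhatLE_trans key (cs.simple_mul_bruhatLE hs)) hs
      rwa [simple_mul_simple_cancel_left] at this
    · refine cs.bruhatLE_trans (ih hx ?_ hn') (cs.simple_mul_bruhatLE hs)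
      intro i hi a b' ha hb'
      obtain ⟨b, hb⟩ := cs.exists_isProj {i}ᶜ y
      have hab := h i hi a b ha hb
      have has := ha.not_isLeftDescent hxs
      rcases hb.simple_mul hs with ⟨hbs, hb2⟩ | ⟨hbs, hb2⟩ <;> rw [hb'.unique hb2]
      · exact cs.bruhatLE_simple_mul_of_not_isLeftDescent hab hbs has
      · exact hab

end Parabolic

end CoxeterSystem

/-- Theorem 1.2: for a parabolic `P` with `Δ \ Δ_P = {α_{j₁}, …, α_{j_r}}` (here
`Δ_P = S`, so the complement of `S`), the effective good divisibility of `G/P` is the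
minimum of those of the Grassmannians `G/P_{j_i}` (where `Δ_{P_{j_i}} = Δ \ {j_i}`):
equivalently, for every `s`, `e.d.(G/P) ≥ s` iff `e.d.(G/P_{j_i}) ≥ s` for all `i`. -/
theorem stmt_17 {M : CoxeterMatrix B} (cs : CoxeterSystem M W) (S : Set B)
    (hproper : Sᶜ.Nonempty)
    (w0 : W) (hw0 : ∀ x : W, cs.length x ≤ cs.length w0)
    (wP : W) (hwP : wP ∈ parabolicSubgroup cs S ∧
      ∀ x ∈ parabolicSubgroup cs S, cs.length x ≤ cs.length wP)
    (wPi : B → W) (hwPi : ∀ i ∉ S, wPi i ∈ parabolicSubgroup cs ({i}ᶜ) ∧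
      ∀ x ∈ parabolicSubgroup cs ({i}ᶜ), cs.length x ≤ cs.length (wPi i)) :
    ∀ s : ℕ, edGE cs S w0 wP s ↔ ∀ i ∉ S, edGE cs ({i}ᶜ) w0 (wPi i) s := by
  intro s
  constructor
  · intro h i hi u v hu hv hlen
    have hS : S ⊆ {i}ᶜ := fun j hj hji ↦ hi (hji ▸ hj)
    have hle := h u v (fun j hj ↦ hu j (hS hj)) (fun j hj ↦ hv j (hS hj)) hlen
    obtain ⟨b, hb⟩ := cs.exists_isProj {i}ᶜ (w0 * v * wP)
    refine cs.bruhatLE_trans (hb.bruhatLE_of_isMinRep hu hle) (IsProj.bruhatLE (hb.of_coset ?_))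
    have : (w0 * v * wP)⁻¹ * (w0 * v * wPi i) = wP⁻¹ * wPi i := by group
    rw [this]
    exact mul_mem (inv_mem (cs.parabolicSubgroup_mono hS hwP.1)) (hwPi i hi).1
  · intro h u v hu hv hlen
    refine bruhatLE_of_forall_isProj hu fun i hi a b ha hb ↦ ?_
    have hS : S ⊆ {i}ᶜ := fun j hj hji ↦ hi (hji ▸ hj)
    obtain ⟨c, hc⟩ := cs.exists_isProj {i}ᶜ v
    have hle := h i hi a c ha.1 hc.1 (by
      have := ha.length_eq
      have := hc.length_eq
      omega)
    refine (hb.of_coset ?_).bruhatLE_of_isMinRep ha.1 hle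
    have : (w0 * v * wP)⁻¹ * (w0 * c * wPi i) = wP⁻¹ * (c⁻¹ * v)⁻¹ * wPi i := by group
    rw [this]
    exact mul_mem (mul_mem (inv_mem (cs.parabolicSubgroup_mono hS hwP.1)) (inv_mem hc.2))
      (hwPi i hi).1
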